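/- For all n ≥ 1, the number of rooted labeled forests on [n] avoiding all three patterns 123, 3412, and 2413 equals n! + ∑ (n!/2^ℓ)·C(n−k−1,ℓ−1)·C(k,ℓ), where the sum is over all pairs (ℓ,k) with 1 ≤ ℓ ≤ k ≤ n and ℓ+k ≤ n, and C(a,b) denotes the binomial coefficient. -/

import Mathlib

/-- A rooted labeled forest on `[n]`, encoded as a parent function
`p : Fin n → Option (Fin n)` (`p v = none` means `v` is a root).
Acyclicity is expressed by the existence of a depth function strictly
decreasing from each vertex to its parent. -/
def IsForest {n : ℕ} (p : Fin n → Option (Fin n)) : Prop :=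
  ∃ d : Fin n → ℕ, ∀ v w : Fin n, p v = some w → d w < d v

/-- `StrictAnc p a b` means `a` is a strict ancestor of `b` in the forest `p`. -/
def StrictAnc {n : ℕ} (p : Fin n → Option (Fin n)) (a b : Fin n) : Prop :=
  Relation.TransGen (fun x y : Fin n => p y = some x) a b

/-- The forest `p` contains the pattern `σ` (given in one-line notation):
there is a chain of vertices along some root-to-vertex path whose labels
are order-isomorphic to `σ`. -/
def ForestContains {n : ℕ} (p : Fin n → Option (Fin n)) (σ : List ℕ) : Prop :=
  ∃ u : Fin σ.length → Fin n,
    (∀ i j : Fin σ.length, i < j → StrictAnc p (u i) (u j)) ∧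
    (∀ i j : Fin σ.length, σ.get i < σ.get j ↔ u i < u j)

/-- The forest `p` avoids the pattern `σ`. -/
def ForestAvoids {n : ℕ} (p : Fin n → Option (Fin n)) (σ : List ℕ) : Prop :=
  ¬ ForestContains p σ

/-- Number of cycles (including fixed points) in the cycle decomposition of a
permutation. -/
def permNumCycles {n : ℕ} (π : Equiv.Perm (Fin n)) : ℕ :=
  π.cycleType.card + (Finset.univ.filter fun x => π x = x).card

/-- Unsigned Stirling number of the first kind: the number of permutations of
`[n]` with exactly `k` cycles. -/
noncomputable def stirlingFirst (n k : ℕ) : ℕ :=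
  Nat.card {π : Equiv.Perm (Fin n) // permNumCycles π = k}

/-- Stirling number of the second kind: the number of partitions of `[n]`
into `k` nonempty subsets. -/
noncomputable def stirlingSecond (n k : ℕ) : ℕ :=
  Nat.card {P : Finpartition (Finset.univ : Finset (Fin n)) // P.parts.card = k}

/-- The Bell number: the number of set partitions of `[n]`. -/
noncomputable def bellNumber (n : ℕ) : ℕ :=
  Nat.card (Finpartition (Finset.univ : Finset (Fin n)))

/-- A vertex is a top-down maximum if it is larger than all of its ancestors. -/
def IsTopDownMax {n : ℕ} (p : Fin n → Option (Fin n)) (v : Fin n) : Prop :=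
  ∀ u : Fin n, StrictAnc p u v → u < v

section Colouring

variable {n : ℕ} {p : Fin n → Option (Fin n)} {χ : Fin n → Bool}

/-- `χ` marks the vertices of `p` whose root path is decreasing, and below an unmarked vertex
the forest stays decreasing. -/
def DescentColouring (χ : Fin n → Bool) (p : Fin n → Option (Fin n)) : Prop :=
  ∀ v, (p v = none → χ v = true) ∧
    ∀ w, p v = some w → (v < w ∧ χ v = χ w) ∨ (w < v ∧ χ w = true ∧ χ v = false)

lemma DescentColouring.isForest (h : DescentColouring χ p) : IsForest p := by
  refine ⟨fun v => if χ v then n - v else 2 * n + 1 - v, fun v w hw => ?_⟩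
  have hv := v.isLt
  have hw' := w.isLt
  rcases (h v).2 w hw with ⟨hlt, heq⟩ | ⟨hlt, h₁, h₂⟩
  · rw [Fin.lt_def] at hlt
    simp only [heq]
    split_ifs <;> omega
  · rw [Fin.lt_def] at hlt
    simp only [h₁, h₂, if_true, Bool.false_eq_true, if_false]
    omega

lemma DescentColouring.of_strictAnc (h : DescentColouring χ p) {a b : Fin n}
    (hab : StrictAnc p a b) : (χ a = χ b ∧ b < a) ∨ (χ a = true ∧ χ b = false) := by
  have edge : ∀ {x y : Fin n}, p y = some x →
      (χ x = χ y ∧ y < x) ∨ (χ x = true ∧ χ y = false) := by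
    intro x y hxy
    rcases (h y).2 x hxy with ⟨hlt, heq⟩ | ⟨-, h₁, h₂⟩
    · exact Or.inl ⟨heq.symm, hlt⟩
    · exact Or.inr ⟨h₁, h₂⟩
  induction hab with
  | single hab => exact edge hab
  | tail _ hbc ih =>
    rcases ih with ⟨h₁, h₂⟩ | ⟨h₁, h₂⟩ <;> rcases edge hbc with ⟨h₃, h₄⟩ | ⟨h₃, h₄⟩
    · exact Or.inl ⟨h₁.trans h₃, h₄.trans h₂⟩
    · exact Or.inr ⟨h₁.trans h₃, h₄⟩
    · exact Or.inr ⟨h₁, h₃.symm.trans h₂⟩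
    · exact Or.inr ⟨h₁, h₄⟩

lemma DescentColouring.of_ascent (h : DescentColouring χ p) {a b : Fin n}
    (hab : StrictAnc p a b) (hlt : a < b) : χ a = true ∧ χ b = false :=
  (h.of_strictAnc hab).resolve_left fun h' => lt_asymm hlt h'.2

lemma DescentColouring.avoids_123 (h : DescentColouring χ p) : ForestAvoids p [1, 2, 3] := by
  rintro ⟨u, hanc, hord⟩
  have h₁ := h.of_ascent (hanc (0 : Fin 3) (1 : Fin 3) (by decide))
    ((hord (0 : Fin 3) (1 : Fin 3)).1 (by decide))
  have h₂ := h.of_ascent (hanc (1 : Fin 3) (2 : Fin 3) (by decide))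
    ((hord (1 : Fin 3) (2 : Fin 3)).1 (by decide))
  exact Bool.false_ne_true (h₁.2.symm.trans h₂.1)

lemma DescentColouring.no_two_ascents (h : DescentColouring χ p) {a b c d : Fin n}
    (hab : StrictAnc p a b) (hbc : StrictAnc p b c) (hcd : StrictAnc p c d)
    (hlt : a < b) (hlt' : c < d) : False := by
  have h₁ := (h.of_ascent hab hlt).2
  have h₂ := (h.of_ascent hcd hlt').1
  rcases h.of_strictAnc hbc with h₃ | h₃ <;> simp_all

lemma DescentColouring.avoids_3412 (h : DescentColouring χ p) :
    ForestAvoids p [3, 4, 1, 2] := by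
  rintro ⟨u, hanc, hord⟩
  exact h.no_two_ascents (hanc (0 : Fin 4) (1 : Fin 4) (by decide))
    (hanc (1 : Fin 4) (2 : Fin 4) (by decide)) (hanc (2 : Fin 4) (3 : Fin 4) (by decide))
    ((hord (0 : Fin 4) (1 : Fin 4)).1 (by decide)) ((hord (2 : Fin 4) (3 : Fin 4)).1 (by decide))

lemma DescentColouring.avoids_2413 (h : DescentColouring χ p) :
    ForestAvoids p [2, 4, 1, 3] := by
  rintro ⟨u, hanc, hord⟩
  exact h.no_two_ascents (hanc (0 : Fin 4) (1 : Fin 4) (by decide))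
    (hanc (1 : Fin 4) (2 : Fin 4) (by decide)) (hanc (2 : Fin 4) (3 : Fin 4) (by decide))
    ((hord (0 : Fin 4) (1 : Fin 4)).1 (by decide)) ((hord (2 : Fin 4) (3 : Fin 4)).1 (by decide))

lemma DescentColouring.unique {χ' : Fin n → Bool} (h : DescentColouring χ p)
    (h' : DescentColouring χ' p) : χ = χ' := by
  obtain ⟨d, hd⟩ := h.isForest
  have key : ∀ N v, d v = N → χ v = χ' v := by
    intro N
    induction N using Nat.strong_induction_on with
    | _ N ih =>
      intro v hv
      cases hp : p v with
      | none => rw [(h v).1 hp, (h' v).1 hp]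
      | some w =>
        have hw := ih (d w) (hv ▸ hd v w hp) w rfl
        rcases (h v).2 w hp with ⟨h₁, h₂⟩ | ⟨h₁, h₂, h₃⟩ <;>
          rcases (h' v).2 w hp with ⟨h₄, h₅⟩ | ⟨h₄, h₅, h₆⟩
        · rw [h₂, h₅, hw]
        · exact absurd h₁ h₄.asymm
        · exact absurd h₁ h₄.asymm
        · rw [h₃, h₆]
  exact funext fun v => key _ v rfl

lemma StrictAnc.trans {a b c : Fin n} (hab : StrictAnc p a b) (hbc : StrictAnc p b c) :
    StrictAnc p a c :=
  Relation.TransGen.trans hab hbc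

lemma IsForest.ne_of_strictAnc (hp : IsForest p) {a b : Fin n} (h : StrictAnc p a b) :
    a ≠ b := by
  obtain ⟨d, hd⟩ := hp
  have : d a < d b := by
    induction h with
    | single h => exact hd _ _ h
    | tail _ h ih => exact ih.trans (hd _ _ h)
  rintro rfl
  exact lt_irrefl _ this

lemma exists_parent_of_strictAnc {a b : Fin n} (h : StrictAnc p a b) :
    ∃ c, p b = some c ∧ (a = c ∨ StrictAnc p a c) := by
  cases h with
  | single h => exact ⟨a, h, Or.inl rfl⟩
  | tail h h' => exact ⟨_, h', Or.inr h⟩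

lemma ForestAvoids.not_123 (h : ForestAvoids p [1, 2, 3]) {a b c : Fin n}
    (hab : StrictAnc p a b) (hbc : StrictAnc p b c) (h₁ : a < b) (h₂ : b < c) : False := by
  refine h ⟨(![a, b, c] : Fin 3 → Fin n), ?_, ?_⟩
  · have hac := hab.trans hbc
    change ∀ i j : Fin 3, _
    intro i j hij
    fin_cases i <;> fin_cases j <;> simp_all
  · have h₃ := h₁.trans h₂
    have := h₁.asymm
    have := h₂.asymm
    have := h₃.asymm
    change ∀ i j : Fin 3, _
    intro i j
    fin_cases i <;> fin_cases j <;> simp_all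

lemma ForestAvoids.not_3412 (h : ForestAvoids p [3, 4, 1, 2]) {a b c d : Fin n}
    (hab : StrictAnc p a b) (hbc : StrictAnc p b c) (hcd : StrictAnc p c d)
    (h₁ : c < d) (h₂ : d < a) (h₃ : a < b) : False := by
  refine h ⟨(![a, b, c, d] : Fin 4 → Fin n), ?_, ?_⟩
  · have hac := hab.trans hbc
    have hbd := hbc.trans hcd
    have had := hab.trans hbd
    change ∀ i j : Fin 4, _
    intro i j hij
    fin_cases i <;> fin_cases j <;> simp_all
  · change ∀ i j : Fin 4, _
    intro i j
    fin_cases i <;> fin_cases j <;> simp <;> order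

lemma ForestAvoids.not_2413 (h : ForestAvoids p [2, 4, 1, 3]) {a b c d : Fin n}
    (hab : StrictAnc p a b) (hbc : StrictAnc p b c) (hcd : StrictAnc p c d)
    (h₁ : c < a) (h₂ : a < d) (h₃ : d < b) : False := by
  refine h ⟨(![a, b, c, d] : Fin 4 → Fin n), ?_, ?_⟩
  · have hac := hab.trans hbc
    have hbd := hbc.trans hcd
    have had := hab.trans hbd
    change ∀ i j : Fin 4, _
    intro i j hij
    fin_cases i <;> fin_cases j <;> simp_all
  · change ∀ i j : Fin 4, _
    intro i j
    fin_cases i <;> fin_cases j <;> simp <;> order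

open Classical in
lemma exists_descentColouring (hp : IsForest p) (h123 : ForestAvoids p [1, 2, 3])
    (h3412 : ForestAvoids p [3, 4, 1, 2]) (h2413 : ForestAvoids p [2, 4, 1, 3]) :
    ∃ χ, DescentColouring χ p := by
  refine ⟨fun v => decide (∀ a b, StrictAnc p a b → (b = v ∨ StrictAnc p b v) → b < a),
    fun v => ⟨fun hv => ?_, fun w hw => ?_⟩⟩
  · have hno : ∀ a, ¬ StrictAnc p a v := by
      intro a ha
      obtain ⟨c, hc, -⟩ := exists_parent_of_strictAnc ha
      simp [hv] at hc
    rw [decide_eq_true_iff]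
    rintro a b hab (rfl | hb)
    · exact absurd hab (hno a)
    · exact absurd hb (hno b)
  · have hwv : StrictAnc p w v := Relation.TransGen.single hw
    have hparent : ∀ {a}, StrictAnc p a v → a = w ∨ StrictAnc p a w := by
      intro a ha
      obtain ⟨c, hc, h⟩ := exists_parent_of_strictAnc ha
      obtain rfl : w = c := Option.some_injective _ (hw.symm.trans hc)
      exact h
    rcases lt_or_gt_of_ne (hp.ne_of_strictAnc hwv) with hlt | hlt
    · refine Or.inr ⟨hlt, ?_, ?_⟩
      · rw [decide_eq_true_iff]
        intro a b hab hbw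
        by_contra hba
        have hab' : a < b := lt_of_le_of_ne (not_lt.1 hba) (hp.ne_of_strictAnc hab)
        rcases hbw with rfl | hbw
        · exact h123.not_123 hab hwv hab' hlt
        have hbv := hbw.trans hwv
        have hav := hab.trans hbv
        rcases lt_or_gt_of_ne (hp.ne_of_strictAnc hbv) with h₁ | h₁
        · exact h123.not_123 hab hbv hab' h₁
        rcases lt_or_gt_of_ne (hp.ne_of_strictAnc (hab.trans hbw)) with h₂ | h₂
        · exact h123.not_123 (hab.trans hbw) hwv h₂ hlt
        rcases lt_or_gt_of_ne (hp.ne_of_strictAnc hav) with h₃ | h₃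
        · exact h2413.not_2413 hab hbw hwv h₂ h₃ h₁
        · exact h3412.not_3412 hab hbw hwv hlt h₃ hab'
      · rw [decide_eq_false_iff_not]
        intro h
        exact lt_asymm hlt (h w v hwv (Or.inl rfl))
    · refine Or.inl ⟨hlt, ?_⟩
      rw [decide_eq_decide]
      constructor
      · rintro h a b hab (rfl | hb)
        · exact h a b hab (Or.inr hwv)
        · exact h a b hab (Or.inr (hb.trans hwv))
      · rintro h a b hab (rfl | hb)
        · rcases hparent hab with rfl | ha
          · exact hlt
          · exact hlt.trans (h a w ha (Or.inl rfl))
        · exact h a b hab (hparent hb)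

lemma avoids_iff_exists_descentColouring :
    (IsForest p ∧ ForestAvoids p [1, 2, 3] ∧ ForestAvoids p [3, 4, 1, 2] ∧
      ForestAvoids p [2, 4, 1, 3]) ↔ ∃ χ, DescentColouring χ p :=
  ⟨fun h => exists_descentColouring h.1 h.2.1 h.2.2.1 h.2.2.2,
    fun ⟨_, h⟩ => ⟨h.isForest, h.avoids_123, h.avoids_3412, h.avoids_2413⟩⟩

end Colouring

section Weight

open Finset

variable {n : ℕ}

/-- For `i = j = 0`, the number of forests with descent colouring `χ`; in general `i` unmarked and
`j` marked vertices larger than all the others are added. -/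
def colouringWeight (i j : ℕ) (χ : Fin n → Bool) : ℕ :=
  ∏ v, if χ v then j + 1 + #{w | v < w ∧ χ w = true}
    else i + #{w | v < w ∧ χ w = false} + #{w | w < v ∧ χ w = true}

/-- The possible parents of `v` in a forest with descent colouring `χ`. -/
def parentChoices (χ : Fin n → Bool) (v : Fin n) : Finset (Option (Fin n)) :=
  if χ v then insertNone {w | v < w ∧ χ w = true}
    else (({w | v < w ∧ χ w = false} : Finset (Fin n)).disjUnion {w | w < v ∧ χ w = true} (by
      rw [disjoint_left]
      intro a ha hb
      simp only [mem_filter_univ] at ha hb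
      exact lt_asymm ha.1 hb.1)).map Function.Embedding.some

lemma descentColouring_iff_mem_piFinset {χ : Fin n → Bool} {p : Fin n → Option (Fin n)} :
    DescentColouring χ p ↔ p ∈ Fintype.piFinset (parentChoices χ) := by
  rw [Fintype.mem_piFinset]
  refine forall_congr' fun v => ?_
  unfold parentChoices
  cases hp : p v with
  | none => cases hv : χ v <;> simp
  | some w => cases hv : χ v <;> cases hw : χ w <;> simp [hw]

lemma prod_card_parentChoices (χ : Fin n → Bool) :
    ∏ v, #(parentChoices χ v) = colouringWeight 0 0 χ := by
  refine prod_congr rfl fun v _ => ?_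
  unfold parentChoices
  split_ifs
  · simp [add_comm]
  · rw [card_map, card_disjUnion, zero_add]

lemma card_avoiding_eq_sum_colouringWeight (n : ℕ) :
    Nat.card {p : Fin n → Option (Fin n) //
        IsForest p ∧ ForestAvoids p [1, 2, 3] ∧ ForestAvoids p [3, 4, 1, 2] ∧
        ForestAvoids p [2, 4, 1, 3]} = ∑ χ : Fin n → Bool, colouringWeight 0 0 χ := by
  classical
  rw [Nat.card_eq_fintype_card, Fintype.card_subtype]
  have : ({p | IsForest p ∧ ForestAvoids p [1, 2, 3] ∧ ForestAvoids p [3, 4, 1, 2] ∧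
      ForestAvoids p [2, 4, 1, 3]} : Finset (Fin n → Option (Fin n))) =
      univ.biUnion fun χ : Fin n → Bool => Fintype.piFinset (parentChoices χ) := by
    ext p
    simp only [mem_filter_univ, mem_biUnion, mem_univ, true_and,
      avoids_iff_exists_descentColouring, descentColouring_iff_mem_piFinset]
  rw [this, card_biUnion]
  · exact sum_congr rfl fun χ _ => by rw [Fintype.card_piFinset, prod_card_parentChoices]
  · intro χ _ χ' _ hne
    rw [Function.onFun, disjoint_left]
    intro p hp hp'
    rw [← descentColouring_iff_mem_piFinset] at hp hp'
    exact hne (hp.unique hp')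

lemma card_filter_fin_succ (P : Fin (n + 1) → Prop) [DecidablePred P] :
    #{v | P v} = #{v | P (Fin.castSucc v)} + if P (Fin.last n) then 1 else 0 := by
  simp only [card_filter, Fin.sum_univ_castSucc]

lemma card_marked_snoc (χ : Fin n → Bool) (b : Bool) :
    #{v | (Fin.snoc χ b : Fin (n + 1) → Bool) v = true} =
      #{v | χ v = true} + if b then 1 else 0 := by
  rw [card_filter_fin_succ (fun v => (Fin.snoc χ b : Fin (n + 1) → Bool) v = true)]
  simp

lemma colouringWeight_snoc_true (i j : ℕ) (χ : Fin n → Bool) :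
    colouringWeight i j (Fin.snoc χ true : Fin (n + 1) → Bool) =
      (j + 1) * colouringWeight i (j + 1) χ := by
  unfold colouringWeight
  rw [Fin.prod_univ_castSucc, mul_comm]
  congr 1
  · simp [card_filter_fin_succ, Fin.le_last]
  · refine prod_congr rfl fun v _ => ?_
    simp [card_filter_fin_succ, Fin.castSucc_lt_last, (Fin.castSucc_lt_last v).asymm]
    split_ifs <;> omega

lemma colouringWeight_snoc_false (i j : ℕ) (χ : Fin n → Bool) :
    colouringWeight i j (Fin.snoc χ false : Fin (n + 1) → Bool) =
      (i + #{v | χ v = true}) * colouringWeight (i + 1) j χ := by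
  unfold colouringWeight
  rw [Fin.prod_univ_castSucc, mul_comm]
  congr 1
  · simp [card_filter_fin_succ, Fin.castSucc_lt_last, Fin.le_last]
  · refine prod_congr rfl fun v _ => ?_
    simp [card_filter_fin_succ, Fin.castSucc_lt_last, (Fin.castSucc_lt_last v).asymm]
    split_ifs <;> omega

/-- The total weight of the colourings with `k` marked vertices. -/
def totalWeight (n i j k : ℕ) : ℕ :=
  ∑ χ : Fin n → Bool, if #{v | χ v = true} = k then colouringWeight i j χ else 0

lemma totalWeight_succ (n i j k : ℕ) :
    totalWeight (n + 1) i j k =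
      (j + 1) * (∑ χ : Fin n → Bool,
        if #{v | χ v = true} + 1 = k then colouringWeight i (j + 1) χ else 0) +
      (i + k) * totalWeight n (i + 1) j k := by
  unfold totalWeight
  rw [← (Fin.snocEquiv fun _ : Fin (n + 1) => Bool).sum_comp, Fintype.sum_prod_type,
    Fintype.sum_bool, mul_sum, mul_sum]
  congr 1 <;> refine sum_congr rfl fun χ _ => ?_
  · change (if #{v | (Fin.snoc χ true : Fin (n + 1) → Bool) v = true} = k then
      colouringWeight i j (Fin.snoc χ true : Fin (n + 1) → Bool) else 0) = _
    rw [card_marked_snoc, colouringWeight_snoc_true]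
    simp
  · change (if #{v | (Fin.snoc χ false : Fin (n + 1) → Bool) v = true} = k then
      colouringWeight i j (Fin.snoc χ false : Fin (n + 1) → Bool) else 0) = _
    rw [card_marked_snoc, colouringWeight_snoc_false]
    by_cases h : #{v | χ v = true} = k <;> simp [h]

lemma totalWeight_succ_zero (n i j : ℕ) :
    totalWeight (n + 1) i j 0 = i * totalWeight n (i + 1) j 0 := by
  simp [totalWeight_succ]

lemma totalWeight_succ_succ (n i j k : ℕ) :
    totalWeight (n + 1) i j (k + 1) =
      (j + 1) * totalWeight n i (j + 1) k + (i + k + 1) * totalWeight n (i + 1) j (k + 1) := by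
  rw [totalWeight_succ]
  simp [totalWeight, add_assoc]

lemma totalWeight_eq_zero_of_lt {i j k : ℕ} (h : n < k) : totalWeight n i j k = 0 := by
  refine sum_eq_zero fun χ _ => if_neg fun hχ => ?_
  have := card_filter_le (univ : Finset (Fin n)) (fun v => χ v = true)
  rw [hχ, card_univ, Fintype.card_fin] at this
  omega

lemma sum_colouringWeight_eq_sum_totalWeight (n : ℕ) :
    ∑ χ : Fin n → Bool, colouringWeight 0 0 χ = ∑ k ∈ range (n + 1), totalWeight n 0 0 k := by
  unfold totalWeight
  rw [sum_comm]
  refine sum_congr rfl fun χ _ => ?_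
  rw [sum_ite_eq, if_pos]
  have := card_filter_le (univ : Finset (Fin n)) (fun v => χ v = true)
  rw [card_univ, Fintype.card_fin] at this
  exact mem_range.2 (by omega)

end Weight

section Series

open PowerSeries Nat

/-- The power series `(1 - X / 2) ^ k / (1 - X) ^ q`. -/
noncomputable def weightSeries (q k : ℕ) : ℚ⟦X⟧ :=
  (1 - C (1 / 2) * X) ^ k * mk 1 ^ q

lemma coeff_zero_weightSeries (q k : ℕ) : coeff 0 (weightSeries q k) = 1 := by
  simp [weightSeries]

lemma derivative_geometric : derivative ℚ (mk 1 : ℚ⟦X⟧) = mk 1 ^ 2 := by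
  rw [mk_one_pow_eq_mk_choose_add]
  ext m
  simp [coeff_derivative, add_comm]

lemma derivative_one_sub_half_X : derivative ℚ (1 - C (1 / 2) * X : ℚ⟦X⟧) = -C (1 / 2) := by
  rw [map_sub, derivative_one, Derivation.leibniz]
  simp

lemma X_mul_derivative_weightSeries_zero (q : ℕ) :
    X * derivative ℚ (weightSeries q 0) = ((q : ℕ) : ℚ⟦X⟧) * (X * weightSeries (q + 1) 0) := by
  cases q with
  | zero => simp [weightSeries]
  | succ q =>
    simp only [weightSeries, derivative_pow, derivative_geometric, pow_zero, one_mul,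
      add_tsub_cancel_right]
    ring

lemma X_mul_derivative_weightSeries_succ (q k : ℕ) :
    X * derivative ℚ (weightSeries (q + 1) (k + 1)) +
        ((k + 1 : ℕ) : ℚ⟦X⟧) * weightSeries (q + 1) (k + 1) =
      ((k + 1 : ℕ) : ℚ⟦X⟧) * weightSeries q k +
        ((q + 1 : ℕ) : ℚ⟦X⟧) * (X * weightSeries (q + 2) (k + 1)) := by
  have hgeom : (mk 1 : ℚ⟦X⟧) * (1 - X) = 1 := mk_one_mul_one_sub_eq_one ℚ
  have hhalf : (C (1 / 2) : ℚ⟦X⟧) * 2 = 1 := by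
    rw [show (2 : ℚ⟦X⟧) = C 2 from (map_ofNat C 2).symm, ← map_mul]
    norm_num
  simp only [weightSeries, Derivation.leibniz, derivative_pow, derivative_geometric,
    derivative_one_sub_half_X, smul_eq_mul, add_tsub_cancel_right]
  generalize (mk 1 : ℚ⟦X⟧) = u at *
  generalize (C (1 / 2) : ℚ⟦X⟧) = c at *
  linear_combination ((k + 1 : ℕ) : ℚ⟦X⟧) * (1 - c * X) ^ k * u ^ q * hgeom -
    ((k + 1 : ℕ) : ℚ⟦X⟧) * (1 - c * X) ^ k * u ^ (q + 1) * X * hhalf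

lemma coeff_weightSeries_zero (q m : ℕ) :
    (m + 1 : ℚ) * coeff (m + 1) (weightSeries q 0) = q * coeff m (weightSeries (q + 1) 0) := by
  have h := congrArg (coeff (m + 1)) (X_mul_derivative_weightSeries_zero q)
  rw [← map_natCast (C (R := ℚ)), coeff_C_mul, coeff_succ_X_mul, coeff_succ_X_mul,
    coeff_derivative] at h
  linear_combination h

lemma coeff_weightSeries_succ (q k m : ℕ) :
    (k + m + 2 : ℚ) * coeff (m + 1) (weightSeries (q + 1) (k + 1)) =
      (k + 1) * coeff (m + 1) (weightSeries q k) +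
        (q + 1) * coeff m (weightSeries (q + 2) (k + 1)) := by
  have h := congrArg (coeff (m + 1)) (X_mul_derivative_weightSeries_succ q k)
  rw [← map_natCast (C (R := ℚ)), ← map_natCast (C (R := ℚ)), map_add, map_add, coeff_C_mul,
    coeff_C_mul, coeff_C_mul, coeff_succ_X_mul, coeff_succ_X_mul, coeff_derivative] at h
  push_cast at h
  linear_combination h

lemma coeff_succ_weightSeries_self {k N : ℕ} (m : ℕ) (hkN : k ≤ N) :
    coeff (m + 1) (weightSeries k k) =
      ∑ l ∈ Finset.Icc 1 N, (k.choose l : ℚ) * m.choose (l - 1) / 2 ^ l := by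
  have hgeom : (mk 1 : ℚ⟦X⟧) * (1 - X) = 1 := mk_one_mul_one_sub_eq_one ℚ
  have hhalf : (C (1 / 2) : ℚ⟦X⟧) * 2 = 1 := by
    rw [show (2 : ℚ⟦X⟧) = C 2 from (map_ofNat C 2).symm, ← map_mul]
    norm_num
  have hbase : (1 - C (1 / 2) * X) * mk 1 = C (1 / 2) * (X * mk 1) + (1 : ℚ⟦X⟧) := by
    linear_combination hgeom - X * mk 1 * hhalf
  have hterm : ∀ l, coeff (m + 1) ((C (1 / 2) * (X * mk 1)) ^ (l + 1) : ℚ⟦X⟧) =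
      (m.choose l : ℚ) / 2 ^ (l + 1) := by
    intro l
    rw [mul_pow, mul_pow, ← map_pow, coeff_C_mul, coeff_X_pow_mul', mk_one_pow_eq_mk_choose_add]
    split_ifs with h
    · rw [coeff_mk, show l + (m + 1 - (l + 1)) = m by omega]
      simp [div_eq_mul_inv, mul_comm]
    · rw [Nat.choose_eq_zero_of_lt (by omega)]
      simp
  rw [weightSeries, ← mul_pow, hbase, add_pow, map_sum]
  simp only [one_pow, mul_one]
  have hcoeff : ∀ l, coeff (m + 1) ((C (1 / 2) * (X * mk 1)) ^ l * ((k.choose l : ℕ) : ℚ⟦X⟧)) =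
      (k.choose l : ℚ) * coeff (m + 1) ((C (1 / 2) * (X * mk 1)) ^ l : ℚ⟦X⟧) := by
    intro l
    rw [← map_natCast (C (R := ℚ)), coeff_mul_C, mul_comm]
  simp only [hcoeff]
  rw [Finset.sum_range_succ']
  simp only [hterm, pow_zero]
  rw [coeff_one, if_neg (Nat.succ_ne_zero m), mul_zero, add_zero]
  have hshift := Finset.sum_Ico_add'
    (fun l => (k.choose l : ℚ) * m.choose (l - 1) / 2 ^ l) 0 k 1
  simp only [add_tsub_cancel_right, zero_add, Nat.Ico_zero_eq_range] at hshift
  simp only [← mul_div_assoc]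
  rw [hshift]
  refine Finset.sum_subset (fun l hl => ?_) fun l _ hl' => ?_
  · simp only [Finset.mem_Ico, Finset.mem_Icc] at hl ⊢
    omega
  · rw [Nat.choose_eq_zero_of_lt (n := k) (k := l)]
    · simp
    · simp_all

lemma factorial_mul_totalWeight (n i j k m : ℕ) (h : k + m = n) :
    (j ! * k ! * totalWeight n i j k : ℚ) =
      (j + k)! * n ! * coeff m (weightSeries (i + k) k) := by
  induction n generalizing i j k m with
  | zero =>
    obtain ⟨rfl, rfl⟩ : k = 0 ∧ m = 0 := by omega
    simp [totalWeight, colouringWeight, coeff_zero_weightSeries]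
  | succ n ih =>
    cases k with
    | zero =>
      obtain rfl : m = n + 1 := by omega
      rw [totalWeight_succ_zero]
      have h₁ := ih (i + 1) j 0 n (by omega)
      have h₂ := coeff_weightSeries_zero i n
      simp only [Nat.factorial_succ, Nat.factorial_zero, add_zero] at h₁ ⊢
      push_cast at h₁ ⊢
      linear_combination i * h₁ - j ! * n ! * h₂
    | succ k =>
      rw [totalWeight_succ_succ]
      cases m with
      | zero =>
        obtain rfl : k = n := by omega
        rw [totalWeight_eq_zero_of_lt (Nat.lt_succ_self k)]
        have h₁ := ih i (j + 1) k 0 rfl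
        rw [coeff_zero_weightSeries] at h₁ ⊢
        rw [show j + 1 + k = j + (k + 1) by ring] at h₁
        simp only [Nat.factorial_succ k, Nat.factorial_succ j] at h₁ ⊢
        push_cast at h₁ ⊢
        linear_combination (k + 1) * h₁
      | succ m =>
        obtain rfl : n = k + m + 1 := by omega
        have h₁ := ih i (j + 1) k (m + 1) (by omega)
        have h₂ := ih (i + 1) j (k + 1) m (by omega)
        have h₃ := coeff_weightSeries_succ (i + k) k m
        rw [show j + 1 + k = j + (k + 1) by ring] at h₁
        rw [show i + 1 + (k + 1) = i + k + 2 by ring] at h₂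
        rw [show i + (k + 1) = i + k + 1 by ring]
        simp only [Nat.factorial_succ k, Nat.factorial_succ j,
          Nat.factorial_succ (k + m + 1)] at h₁ h₂ ⊢
        push_cast at h₁ h₂ h₃ ⊢
        linear_combination (k + 1) * h₁ + (i + k + 1) * h₂ - (j + (k + 1))! * (k + m + 1)! * h₃

lemma totalWeight_eq_factorial_mul_coeff (k m : ℕ) :
    (totalWeight (k + m) 0 0 k : ℚ) = (k + m)! * coeff m (weightSeries k k) := by
  have h := factorial_mul_totalWeight (k + m) 0 0 k m rfl
  simp only [zero_add, Nat.factorial_zero, Nat.cast_one, one_mul, mul_assoc] at h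
  exact mul_left_cancel₀ (by positivity) h

lemma two_pow_dvd_factorial_two_mul (l : ℕ) : 2 ^ l ∣ (2 * l)! := by
  induction l with
  | zero => simp
  | succ l ih =>
    rw [show 2 * (l + 1) = 2 * l + 1 + 1 by ring, Nat.factorial_succ, Nat.factorial_succ, pow_succ']
    exact mul_dvd_mul ⟨l + 1, by ring⟩ (ih.mul_left _)

lemma totalWeight_self (n : ℕ) : totalWeight n 0 0 n = n ! := by
  have h := totalWeight_eq_factorial_mul_coeff n 0
  rw [coeff_zero_weightSeries, mul_one, add_zero] at h
  exact_mod_cast h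

lemma totalWeight_eq_sum {n k : ℕ} (hk : k < n) :
    totalWeight n 0 0 k = ∑ l ∈ Finset.Icc 1 n, if l ≤ k ∧ l + k ≤ n then
      n ! / 2 ^ l * (n - k - 1).choose (l - 1) * k.choose l else 0 := by
  obtain ⟨m, rfl⟩ := Nat.exists_eq_add_of_lt hk
  have h := totalWeight_eq_factorial_mul_coeff k (m + 1)
  rw [coeff_succ_weightSeries_self m (show k ≤ k + m + 1 by omega), Finset.mul_sum] at h
  rw [← Nat.cast_inj (R := ℚ), add_assoc, h, Nat.cast_sum]
  refine Finset.sum_congr rfl fun l hl => ?_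
  have hl' := (Finset.mem_Icc.1 hl).1
  rw [show k + (m + 1) - k - 1 = m by omega]
  split_ifs with hlk
  · have hdvd : 2 ^ l ∣ (k + (m + 1))! :=
      (two_pow_dvd_factorial_two_mul l).trans (Nat.factorial_dvd_factorial (by omega))
    rw [Nat.cast_mul, Nat.cast_mul, Nat.cast_div hdvd (by positivity)]
    push_cast
    ring
  · rcases not_and_or.1 hlk with hlk | hlk
    · rw [Nat.choose_eq_zero_of_lt (not_le.1 hlk)]
      simp
    · rw [Nat.choose_eq_zero_of_lt (n := m) (k := l - 1) (by omega)]
      simp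

end Series

theorem count_forests_avoiding_123_3412_2413 (n : ℕ) (hn : 1 ≤ n) :
    Nat.card {p : Fin n → Option (Fin n) //
        IsForest p ∧ ForestAvoids p [1, 2, 3] ∧ ForestAvoids p [3, 4, 1, 2] ∧
        ForestAvoids p [2, 4, 1, 3]} =
    n.factorial +
      ∑ lk ∈ (Finset.Icc 1 n ×ˢ Finset.Icc 1 n).filter
          (fun lk => lk.1 ≤ lk.2 ∧ lk.1 + lk.2 ≤ n),
        (n.factorial / 2 ^ lk.1) * (n - lk.2 - 1).choose (lk.1 - 1) * lk.2.choose lk.1 := by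
  rw [card_avoiding_eq_sum_colouringWeight, sum_colouringWeight_eq_sum_totalWeight,
    Finset.sum_range_succ, totalWeight_self, add_comm, add_right_inj, Finset.sum_filter,
    Finset.sum_product_right,
    Finset.sum_congr rfl fun k hk => totalWeight_eq_sum (Finset.mem_range.1 hk)]
  refine Finset.sum_congr_of_eq_on_inter (fun k hk hk' => ?_) (fun k hk hk' => ?_) fun _ _ _ => rfl
  all_goals
    simp only [Finset.mem_Icc, Finset.mem_range] at hk hk'
    refine Finset.sum_eq_zero fun l hl => if_neg ?_
    have := Finset.mem_Icc.1 hl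
    omega
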